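/- Assume the critical distance satisfies b > 2. Then every element a ∈ Z_v fixes x and x+1 and permutes Γ(x) \ {x+1} preserving criticality: for every t ∈ Γ(x) \ {x+1}, (t, v−1) ∈ 𝒞 if and only if (t^a, v−1) ∈ 𝒞. In particular Z_v fixes setwise both 𝒞_{−1}(x,v) = {t ∈ Γ(x) \ {x+1} : (t,v−1) ∈ 𝒞} and its complement 𝒞*_{−1}(x,v) = {t ∈ Γ(x) \ {x+1} : (t,v−1) ∉ 𝒞}. -/

import Mathlib

open MulAction Pointwise

/-- `V`, the `n`-dimensional vector space over the field with 3 elements. -/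
abbrev Vec (n : ℕ) := Fin n → ZMod 3

/-- The translation subgroup `V` of `Perm (Vec n)`. -/
def TransGrp (n : ℕ) : Subgroup (Equiv.Perm (Vec n)) :=
  Subgroup.closure {f : Equiv.Perm (Vec n) | ∃ w, ∀ v, f v = v + w}

/-- The Frobenius group `L = V ⋊ C₂` of order `2·3^n`, acting on `V = Vec n`
by `v ↦ ε·v + w` with `ε = ±1`: it is generated by the translations and negation. -/
def Lgrp (n : ℕ) : Subgroup (Equiv.Perm (Vec n)) :=
  Subgroup.closure ({f : Equiv.Perm (Vec n) | ∃ w, ∀ v, f v = v + w} ∪ {Equiv.neg (Vec n)})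

/-- The pointwise stabilizer `G_u^{[s]}` in `G` of the ball of radius `s` around `u`. -/
def ballStab {α : Type*} (Γ : SimpleGraph α) (G : Type*) [Group G] [MulAction G α]
    (u : α) (s : ℕ) : Subgroup G :=
  ⨅ w ∈ {w : α | Γ.dist u w ≤ s}, stabilizer G w

/-- `Z_{uw} = Ω₁(Z(G_u ∩ G_w))`, the subgroup generated by the elements of order at most 2
of the centre of the arc stabilizer `G_u ∩ G_w`. -/
def Zuw {α : Type*} (G : Type*) [Group G] [MulAction G α] (u w : α) : Subgroup G :=
  Subgroup.closure {g : G |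
    g ∈ (stabilizer G u ⊓ stabilizer G w) ⊓
        Subgroup.centralizer ((stabilizer G u ⊓ stabilizer G w : Subgroup G) : Set G) ∧ g ^ 2 = 1}

/-- `Z_u = ⟨Z_{uw}^{G_u}⟩`, the normal closure in `G_u` of the subgroups `Z_{uw}`,
for `w` a neighbour of `u` (independent of the choice of `w` by arc-transitivity). -/
def Zsub {α : Type*} (Γ : SimpleGraph α) (G : Type*) [Group G] [MulAction G α]
    (u : α) : Subgroup G :=
  Subgroup.closure {k : G | ∃ h ∈ stabilizer G u, ∃ w ∈ Γ.neighborSet u,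
    ∃ g ∈ Zuw G u w, k = h * g * h⁻¹}

/-- The critical distance `b = min { d(u,v) : Z_u ≰ G_v^{[1]} }`. -/
noncomputable def critDist {α : Type*} (Γ : SimpleGraph α) (G : Type*) [Group G]
    [MulAction G α] : ℕ :=
  sInf {d : ℕ | ∃ u v : α, Γ.dist u v = d ∧ ¬ Zsub Γ G u ≤ ballStab Γ G v 1}

/-- `(u,v)` is a critical pair: `d(u,v) = b` and `Z_u ≰ G_v^{[1]}`. -/
def critPair {α : Type*} (Γ : SimpleGraph α) (G : Type*) [Group G] [MulAction G α]
    (u v : α) : Prop :=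
  Γ.dist u v = critDist Γ G ∧ ¬ Zsub Γ G u ≤ ballStab Γ G v 1

/-- `(Γ, G)` is locally `L`: for each vertex `u` there is a bijection
`φ : Γ(u) ≃ V` conjugating the permutation group induced by `G_u` on `Γ(u)`
to exactly the permutation group `L` acting on `V`. -/
def LocallyL {α : Type*} (n : ℕ) (Γ : SimpleGraph α) (G : Type*) [Group G]
    [MulAction G α] : Prop :=
  ∀ u : α, ∃ φ : Γ.neighborSet u ≃ Vec n,
    (∀ g ∈ stabilizer G u, ∃ l ∈ Lgrp n, ∀ z : Γ.neighborSet u,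
      ∃ hz : (g • (z : α)) ∈ Γ.neighborSet u, φ ⟨g • (z : α), hz⟩ = l (φ z)) ∧
    (∀ l ∈ Lgrp n, ∃ g ∈ stabilizer G u, ∀ z : Γ.neighborSet u,
      ∃ hz : (g • (z : α)) ∈ Γ.neighborSet u, φ ⟨g • (z : α), hz⟩ = l (φ z))

open SimpleGraph in
theorem graph_dist_smul_le {α G : Type*} [Group G] [MulAction G α] {Γ : SimpleGraph α}
    (hconn : Γ.Connected) (haut : ∀ (g : G) (u w : α), Γ.Adj u w ↔ Γ.Adj (g • u) (g • w))
    (g : G) (u w : α) : Γ.dist (g • u) (g • w) ≤ Γ.dist u w := by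
  obtain ⟨q, hq⟩ := hconn.exists_walk_length_eq_dist u w
  let f : Γ →g Γ := ⟨fun z => g • z, fun {c d} h => (haut g c d).1 h⟩
  have h := dist_le (q.map f)
  rw [Walk.length_map, hq] at h
  exact h

theorem graph_dist_smul_smul {α G : Type*} [Group G] [MulAction G α] {Γ : SimpleGraph α}
    (hconn : Γ.Connected) (haut : ∀ (g : G) (u w : α), Γ.Adj u w ↔ Γ.Adj (g • u) (g • w))
    (g : G) (u w : α) : Γ.dist (g • u) (g • w) = Γ.dist u w :=
  le_antisymm (graph_dist_smul_le hconn haut g u w)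
    (by simpa using graph_dist_smul_le hconn haut g⁻¹ (g • u) (g • w))

theorem mem_ballStab {α G : Type*} [Group G] [MulAction G α] {Γ : SimpleGraph α} {u : α} {s : ℕ}
    {g : G} : g ∈ ballStab Γ G u s ↔ ∀ w, Γ.dist u w ≤ s → g • w = w := by
  simp [ballStab, Subgroup.mem_iInf, mem_stabilizer_iff]

theorem conj_mem_stabilizer_smul {α G : Type*} [Group G] [MulAction G α] {u : α} (a : G) {h : G}
    (hh : h ∈ stabilizer G u) : a * h * a⁻¹ ∈ stabilizer G (a • u) := by
  rw [mem_stabilizer_iff] at *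
  simp [mul_smul, hh]

theorem conj_mem_Zuw_smul {α G : Type*} [Group G] [MulAction G α] {u w : α} (a : G) {g : G}
    (hg : g ∈ Zuw G u w) : a * g * a⁻¹ ∈ Zuw G (a • u) (a • w) := by
  suffices h : Zuw G u w ≤ (Zuw G (a • u) (a • w)).comap (MulAut.conj a).toMonoidHom from h hg
  refine (Subgroup.closure_le _).2 ?_
  rintro k ⟨⟨⟨hku, hkw⟩, hkc⟩, hk2⟩
  refine Subgroup.subset_closure ⟨⟨⟨conj_mem_stabilizer_smul a hku,
    conj_mem_stabilizer_smul a hkw⟩, ?_⟩, ?_⟩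
  · refine Subgroup.mem_centralizer_iff.2 ?_
    rintro m ⟨hmu, hmw⟩
    have hu := conj_mem_stabilizer_smul a⁻¹ hmu
    have hw := conj_mem_stabilizer_smul a⁻¹ hmw
    rw [inv_smul_smul, inv_inv] at hu hw
    have hc := Subgroup.mem_centralizer_iff.1 hkc _ ⟨hu, hw⟩
    calc m * (a * k * a⁻¹) = a * (a⁻¹ * m * a * k) * a⁻¹ := by group
      _ = a * (k * (a⁻¹ * m * a)) * a⁻¹ := by rw [hc]
      _ = a * k * a⁻¹ * m := by group
  · change (a * k * a⁻¹) ^ 2 = 1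
    rw [conj_pow, hk2]
    simp

theorem conj_mem_Zsub_smul {α G : Type*} [Group G] [MulAction G α] {Γ : SimpleGraph α}
    (haut : ∀ (g : G) (u w : α), Γ.Adj u w ↔ Γ.Adj (g • u) (g • w))
    {u : α} (a : G) {g : G} (hg : g ∈ Zsub Γ G u) : a * g * a⁻¹ ∈ Zsub Γ G (a • u) := by
  suffices h : Zsub Γ G u ≤ (Zsub Γ G (a • u)).comap (MulAut.conj a).toMonoidHom from h hg
  refine (Subgroup.closure_le _).2 ?_
  rintro _ ⟨h, hh, w, hw, k, hk, rfl⟩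
  refine Subgroup.subset_closure ⟨a * h * a⁻¹, conj_mem_stabilizer_smul a hh, a • w,
    (haut a u w).1 hw, a * k * a⁻¹, conj_mem_Zuw_smul a hk, ?_⟩
  change a * (h * k * h⁻¹) * a⁻¹ = _
  group

theorem critPair.smul {α G : Type*} [Group G] [MulAction G α] {Γ : SimpleGraph α}
    (hconn : Γ.Connected) (haut : ∀ (g : G) (u w : α), Γ.Adj u w ↔ Γ.Adj (g • u) (g • w))
    {u w : α} (h : critPair Γ G u w) (a : G) : critPair Γ G (a • u) (a • w) := by
  refine ⟨(graph_dist_smul_smul hconn haut a u w).trans h.1, fun hle => h.2 fun k hk => ?_⟩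
  have hb := mem_ballStab.1 (hle (conj_mem_Zsub_smul haut a hk))
  refine mem_ballStab.2 fun z hz => ?_
  have hz' := hb (a • z) ((graph_dist_smul_smul hconn haut a w z).trans_le hz)
  simpa [mul_smul] using hz'

theorem critPair_smul_iff {α G : Type*} [Group G] [MulAction G α] {Γ : SimpleGraph α}
    (hconn : Γ.Connected) (haut : ∀ (g : G) (u w : α), Γ.Adj u w ↔ Γ.Adj (g • u) (g • w))
    {u w : α} (a : G) : critPair Γ G (a • u) (a • w) ↔ critPair Γ G u w :=
  ⟨fun h => by simpa using h.smul hconn haut a⁻¹, fun h => h.smul hconn haut a⟩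

theorem Zsub_le_ballStab_of_dist_lt {α G : Type*} [Group G] [MulAction G α] {Γ : SimpleGraph α}
    {u w : α} (h : Γ.dist u w < critDist Γ G) : Zsub Γ G u ≤ ballStab Γ G w 1 := by
  by_contra hn
  exact Nat.notMem_of_lt_sInf h ⟨u, w, rfl, hn⟩

theorem dist_le_of_adj_succ {α : Type*} {Γ : SimpleGraph α} (hconn : Γ.Connected) (p : ℕ → α)
    (i k : ℕ) (h : ∀ j, i ≤ j → j < i + k → Γ.Adj (p j) (p (j + 1))) :
    Γ.dist (p i) (p (i + k)) ≤ k := by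
  induction k with
  | zero => simp
  | succ k ih =>
    have h1 := ih fun j hj hjk => h j hj (by omega)
    have h2 := SimpleGraph.dist_eq_one_iff_adj.2 (h (i + k) (by omega) (by omega))
    have h3 := hconn.dist_triangle (u := p i) (v := p (i + k)) (w := p (i + k + 1))
    rw [← add_assoc]
    omega

/-- if `b > 2`, every `a ∈ Z_v` fixes `x` and `x+1` and permutes
`Γ(x) \\ {x+1}` preserving criticality of pairs `(t, v-1)`; in particular `Z_v` fixes
setwise `𝒞₋₁(x,v)` and `𝒞*₋₁(x,v)`. -/
theorem Zv_preserves_criticality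
    {α : Type*} (n : ℕ) (hn : 2 ≤ n) (Γ : SimpleGraph α)
    (G : Type*) [Group G] [MulAction G α]
    (hconn : Γ.Connected) (hacyc : Γ.IsAcyclic)
    (haut : ∀ (g : G) (u w : α), Γ.Adj u w ↔ Γ.Adj (g • u) (g • w))
    (hfaith : ∀ g : G, (∀ u : α, g • u = u) → g = 1)
    (harc : ∀ u w u' w' : α, Γ.Adj u w → Γ.Adj u' w' → ∃ g : G, g • u = u' ∧ g • w = w')
    (hfin : ∀ u : α, Finite (stabilizer G u))
    (hloc : LocallyL n Γ G)
    (x y : α) (hxy : Γ.Adj x y)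
    (hntriv : ballStab Γ G x 1 ⊓ ballStab Γ G y 1 ≠ ⊥)
    (v : α) (hcrit : critPair Γ G x v)
    (b : ℕ) (hb : b = critDist Γ G)
    (p : ℕ → α) (hp0 : p 0 = x) (hpb : p b = v)
    (hpadj : ∀ i, i < b → Γ.Adj (p i) (p (i + 1)))
    (hy : y = p 1)
    (hbgt : 2 < b) :
    ∀ a ∈ Zsub Γ G v, a • x = x ∧ a • (p 1) = p 1 ∧
      ∀ t ∈ Γ.neighborSet x, t ≠ p 1 →
        (a • t ∈ Γ.neighborSet x ∧ a • t ≠ p 1 ∧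
          (critPair Γ G t (p (b - 1)) ↔ critPair Γ G (a • t) (p (b - 1)))) := by
  subst hb hp0 hpb hy
  set b := critDist Γ G
  intro a ha
  have hfix : ∀ i, 1 ≤ i → i ≤ b → ∀ z, Γ.dist (p i) z ≤ 1 → a • z = z := by
    intro i hi hib
    have hd := dist_le_of_adj_succ hconn p i (b - i) fun j _ hj => hpadj j (by omega)
    rw [Nat.add_sub_cancel' hib, SimpleGraph.dist_comm] at hd
    exact mem_ballStab.1 (Zsub_le_ballStab_of_dist_lt (by omega) ha)
  have hx : a • p 0 = p 0 :=
    hfix 1 le_rfl (by omega) _ (SimpleGraph.dist_eq_one_iff_adj.2 hxy.symm).le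
  have h1 : a • p 1 = p 1 := hfix 1 le_rfl (by omega) _ (by simp)
  have hv : a • p (b - 1) = p (b - 1) := hfix (b - 1) (by omega) (by omega) _ (by simp)
  refine ⟨hx, h1, fun t ht htne => ⟨?_, fun h => htne ?_, ?_⟩⟩
  · have := (haut a (p 0) t).1 ht
    rwa [hx] at this
  · exact MulAction.injective a (h.trans h1.symm)
  · have := critPair_smul_iff hconn haut (u := t) (w := p (b - 1)) a
    rw [hv] at this
    exact this.symm
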